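/- arXiv:1312.4487 — 3 statements merged into one kernel-verified Lean document; each statement's English description precedes it below -/
import Mathlib

section
/- If a permutation of {1,...,n} is produced by some operation sequence of two stacks in parallel, then it is produced by an operation sequence that outputs eagerly. -/
/-!
Two stacks in parallel: operation sequences over the alphabet {I1, I2, O1, O2}.
-/

inductive Op : Type
  | I1 | I2 | O1 | O2
  deriving DecidableEq

/-- Machine state: (next unread input item, stack 1, stack 2, output so far). -/
abbrev MState := ℕ × List ℕ × List ℕ × List ℕ

/-- One step of the two-stack machine. -/
def mstep : MState → Op → MState
  | (k, s1, s2, out), Op.I1 => (k + 1, k :: s1, s2, out)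
  | (k, s1, s2, out), Op.I2 => (k + 1, s1, k :: s2, out)
  | (k, s1, s2, out), Op.O1 => (k, s1.tail, s2, out ++ [s1.headI])
  | (k, s1, s2, out), Op.O2 => (k, s1, s2.tail, out ++ [s2.headI])

/-- Run a word on the two-stack machine, starting with input item 1. -/
def mrun (w : List Op) : MState := w.foldl mstep (1, [], [], [])

/-- The output word (the permutation produced, as a list). -/
def output (w : List Op) : List ℕ := (mrun w).2.2.2

def h1 : Op → ℤ
  | Op.I1 => 1
  | Op.O1 => -1
  | _ => 0

def h2 : Op → ℤ
  | Op.I2 => 1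
  | Op.O2 => -1
  | _ => 0

/-- `w` is an operation sequence: each projection on `{Ii, Oi}` is a Dyck word. -/
def IsOpSeq (w : List Op) : Prop :=
  (w.map h1).sum = 0 ∧ (w.map h2).sum = 0 ∧
    ∀ p ∈ w.inits, 0 ≤ (p.map h1).sum ∧ 0 ≤ (p.map h2).sum

/-- `w` outputs eagerly: it contains neither `I1 O2` nor `I2 O1` as a factor. -/
def Eager (w : List Op) : Prop :=
  ¬ [Op.I1, Op.O2] <:+: w ∧ ¬ [Op.I2, Op.O1] <:+: w

/-- The number of pairs of positions in `w` whose left entry is an input letter. -/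
def inputWeight : List Op → ℕ
  | [] => 0
  | Op.I1 :: t => t.length + inputWeight t
  | Op.I2 :: t => t.length + inputWeight t
  | _ :: t => inputWeight t

/-- `x` is an input to one stack and `y` an output from the other one. -/
def LatePair (x y : Op) : Prop := (x = Op.I1 ∧ y = Op.O2) ∨ (x = Op.I2 ∧ y = Op.O1)

theorem inputWeight_append_lt (a : List Op) {u v : List Op} (hl : u.length = v.length)
    (h : inputWeight u < inputWeight v) : inputWeight (a ++ u) < inputWeight (a ++ v) := by
  induction a with
  | nil => exact h
  | cons x a ih => cases x <;> simp [inputWeight, hl, ih]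

theorem LatePair.inputWeight_swap_lt {x y : Op} (h : LatePair x y) (a b : List Op) :
    inputWeight (a ++ y :: x :: b) < inputWeight (a ++ x :: y :: b) := by
  apply inputWeight_append_lt a (by simp)
  rcases h with ⟨rfl, rfl⟩ | ⟨rfl, rfl⟩ <;> simp [inputWeight]

theorem LatePair.output_swap {x y : Op} (h : LatePair x y) (a b : List Op) :
    output (a ++ y :: x :: b) = output (a ++ x :: y :: b) := by
  rcases h with ⟨rfl, rfl⟩ | ⟨rfl, rfl⟩ <;> simp [output, mrun, mstep]

theorem LatePair.isOpSeq_swap {x y : Op} (h : LatePair x y) {a b : List Op}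
    (hw : IsOpSeq (a ++ x :: y :: b)) : IsOpSeq (a ++ y :: x :: b) := by
  obtain ⟨e1, e2, hp⟩ := hw
  simp only [List.mem_inits] at hp
  simp only [List.map_append, List.map_cons, List.sum_append, List.sum_cons] at e1 e2
  refine ⟨?_, ?_, fun p h_pre => ?_⟩
  · simp only [List.map_append, List.map_cons, List.sum_append, List.sum_cons]
    linarith
  · simp only [List.map_append, List.map_cons, List.sum_append, List.sum_cons]
    linarith
  · rw [List.mem_inits] at h_pre
    rcases List.prefix_or_prefix_of_prefix h_pre (List.prefix_append a _) with hpa | ⟨t, rfl⟩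
    · exact hp p (hpa.trans (List.prefix_append _ _))
    · have ht := (List.prefix_append_right_inj a).1 h_pre
      have ha := hp a (List.prefix_append _ _)
      have haxy := hp (a ++ [x, y]) ⟨b, by simp⟩
      rcases List.prefix_cons_iff.1 ht with rfl | ⟨s, rfl, hs⟩
      · simpa using ha
      · rcases List.prefix_cons_iff.1 hs with rfl | ⟨r, rfl, hr⟩
        · rcases h with ⟨rfl, rfl⟩ | ⟨rfl, rfl⟩ <;> simp [h1, h2] at ha haxy ⊢ <;> omega
        · have hz := hp (a ++ x :: y :: r) (by simpa using hr)
          simp only [List.map_append, List.map_cons, List.sum_append, List.sum_cons] at hz ⊢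
          constructor <;> linarith [hz.1, hz.2]

theorem exists_latePair_of_not_eager {w : List Op} (h : ¬ Eager w) :
    ∃ x y a b, LatePair x y ∧ w = a ++ x :: y :: b := by
  rw [Eager, not_and_or, not_not, not_not] at h
  rcases h with ⟨a, b, rfl⟩ | ⟨a, b, rfl⟩
  · exact ⟨_, _, a, b, Or.inl ⟨rfl, rfl⟩, by simp⟩
  · exact ⟨_, _, a, b, Or.inr ⟨rfl, rfl⟩, by simp⟩

/-- If a permutation is produced by some operation sequence of two stacks in
parallel, then it is produced by an operation sequence that outputs eagerly. -/
theorem produced_by_eager (w : List Op) (hw : IsOpSeq w) :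
    ∃ v : List Op, IsOpSeq v ∧ Eager v ∧ output v = output w := by
  induction hm : inputWeight w using Nat.strong_induction_on generalizing w with
  | _ m ih =>
    subst hm
    by_cases he : Eager w
    · exact ⟨w, hw, he, rfl⟩
    · obtain ⟨x, y, a, b, h, rfl⟩ := exists_latePair_of_not_eager he
      obtain ⟨v, hv, hev, hov⟩ := ih _ (h.inputWeight_swap_lt a b) _ (h.isOpSeq_swap hw) rfl
      exact ⟨v, hv, hev, hov.trans (h.output_swap a b)⟩
end

section
/- Let (f_n)_{n >= 0} be a sequence of polynomials with nonnegative integer coefficients such that f_n has degree at most n and f_n is nonzero for infinitely many n. For a real number a >= 0, let rho(a) in [0, +infinity] be the radius of convergence of the power series sum_n f_n(a) u^n. Then rho is non-increasing on [0, +infinity), rho(a) is finite for every a > 0, and rho is continuous on (0, +infinity). Moreover, for 0 < a <= a' one has rho(a') >= (a/a') * rho(a). -/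
/-- The radius of convergence (in `[0,∞]`) of a real power series with
coefficients `c`: the supremum of all `r ≥ 0` such that `∑ c n * r^n`
converges. -/
noncomputable def radius (c : ℕ → ℝ) : ENNReal :=
  sSup {r : ENNReal | ∃ x : NNReal, r = x ∧ Summable fun n => c n * (x : ℝ) ^ n}

/-- `rho f a` is the radius of convergence of `∑ f_n(a) u^n`, where the
polynomials `f_n` (with nonnegative integer coefficients) are evaluated
at the real number `a`. -/
noncomputable def rho (f : ℕ → Polynomial ℕ) (a : ℝ) : ENNReal :=
  radius fun n => Polynomial.eval₂ (Nat.castRingHom ℝ) a (f n)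

open Filter Topology Finset

lemma eval₂_castRingHom_nonneg (p : Polynomial ℕ) {a : ℝ} (ha : 0 ≤ a) :
    0 ≤ p.eval₂ (Nat.castRingHom ℝ) a := by
  rw [Polynomial.eval₂_eq_sum_range]
  exact sum_nonneg fun i _ => mul_nonneg (Nat.cast_nonneg _) (pow_nonneg ha i)

lemma eval₂_castRingHom_mono (p : Polynomial ℕ) {a b : ℝ} (ha : 0 ≤ a) (hab : a ≤ b) :
    p.eval₂ (Nat.castRingHom ℝ) a ≤ p.eval₂ (Nat.castRingHom ℝ) b := by
  simp only [Polynomial.eval₂_eq_sum_range]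
  exact sum_le_sum fun i _ =>
    mul_le_mul_of_nonneg_left (pow_le_pow_left₀ ha hab i) (Nat.cast_nonneg _)

lemma eval₂_castRingHom_mul_le (p : Polynomial ℕ) {n : ℕ} (hp : p.natDegree ≤ n) {a c : ℝ}
    (ha : 0 ≤ a) (hc : 1 ≤ c) :
    p.eval₂ (Nat.castRingHom ℝ) (c * a) ≤ c ^ n * p.eval₂ (Nat.castRingHom ℝ) a := by
  simp only [Polynomial.eval₂_eq_sum_range, mul_sum]
  refine sum_le_sum fun i hi => ?_
  have hin : i ≤ n := (Nat.lt_succ_iff.mp (mem_range.mp hi)).trans hp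
  calc (Nat.castRingHom ℝ) (p.coeff i) * (c * a) ^ i
      = c ^ i * ((Nat.castRingHom ℝ) (p.coeff i) * a ^ i) := by rw [mul_pow]; ring
    _ ≤ c ^ n * ((Nat.castRingHom ℝ) (p.coeff i) * a ^ i) :=
        mul_le_mul_of_nonneg_right (pow_le_pow_right₀ hc hin)
          (mul_nonneg (Nat.cast_nonneg _) (pow_nonneg ha i))

lemma min_one_pow_le_eval₂_castRingHom {p : Polynomial ℕ} (hp0 : p ≠ 0) {n : ℕ}
    (hp : p.natDegree ≤ n) {a : ℝ} (ha : 0 < a) :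
    min 1 a ^ n ≤ p.eval₂ (Nat.castRingHom ℝ) a := by
  have hm : 0 < min 1 a := lt_min one_pos ha
  have hlead : (1 : ℝ) ≤ (Nat.castRingHom ℝ) (p.coeff p.natDegree) := by
    have h : 1 ≤ p.coeff p.natDegree :=
      Nat.one_le_iff_ne_zero.mpr (Polynomial.leadingCoeff_ne_zero.mpr hp0)
    simpa using (Nat.cast_le (α := ℝ)).mpr h
  calc min 1 a ^ n ≤ min 1 a ^ p.natDegree :=
        pow_le_pow_of_le_one hm.le (min_le_left _ _) hp
    _ ≤ a ^ p.natDegree := pow_le_pow_left₀ hm.le (min_le_right _ _) _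
    _ ≤ (Nat.castRingHom ℝ) (p.coeff p.natDegree) * a ^ p.natDegree :=
        le_mul_of_one_le_left (pow_nonneg ha.le _) hlead
    _ ≤ p.eval₂ (Nat.castRingHom ℝ) a := by
        rw [Polynomial.eval₂_eq_sum_range]
        exact single_le_sum (f := fun i => (Nat.castRingHom ℝ) (p.coeff i) * a ^ i)
          (fun i _ => mul_nonneg (Nat.cast_nonneg _) (pow_nonneg ha.le i))
          (self_mem_range_succ _)

/-- Termwise domination of `d n * t ^ n` by `c n` scales the radius of convergence by `t`. -/
lemma mul_radius_le_radius {c d : ℕ → ℝ} (t : NNReal) (hd : ∀ n, 0 ≤ d n)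
    (h : ∀ n, d n * (t : ℝ) ^ n ≤ c n) : (t : ENNReal) * radius c ≤ radius d := by
  unfold radius
  rw [ENNReal.mul_sSup]
  refine iSup₂_le ?_
  rintro _ ⟨x, rfl, hx⟩
  refine le_sSup ⟨t * x, by push_cast; rfl, ?_⟩
  refine Summable.of_nonneg_of_le (fun n => mul_nonneg (hd n) (pow_nonneg (NNReal.coe_nonneg _) n))
    (fun n => ?_) hx
  calc d n * ((t * x : NNReal) : ℝ) ^ n = d n * (t : ℝ) ^ n * (x : ℝ) ^ n := by
        push_cast; rw [mul_pow]; ring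
    _ ≤ c n * (x : ℝ) ^ n := mul_le_mul_of_nonneg_right (h n) (pow_nonneg x.coe_nonneg n)

/-- If `m ^ n ≤ c n` for infinitely many `n`, the radius of convergence is at most `1 / m`. -/
lemma radius_lt_top_of_frequently_pow_le {c : ℕ → ℝ} {m : ℝ} (hm : 0 < m)
    (h : ∀ N, ∃ n, N ≤ n ∧ m ^ n ≤ c n) : radius c < ⊤ := by
  refine lt_of_le_of_lt (sSup_le ?_) (ENNReal.ofReal_lt_top (r := m⁻¹))
  rintro _ ⟨x, rfl, hx⟩
  rw [← ENNReal.ofReal_coe_nnreal]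
  refine ENNReal.ofReal_le_ofReal ?_
  by_contra! hlt
  have hone : 1 ≤ m * x := by
    have := mul_lt_mul_of_pos_left hlt hm
    rw [mul_inv_cancel₀ hm.ne'] at this
    exact this.le
  obtain ⟨N, hN⟩ := eventually_atTop.mp (hx.tendsto_atTop_zero.eventually (gt_mem_nhds one_pos))
  obtain ⟨n, hn, hmn⟩ := h N
  refine (hN n hn).not_ge ?_
  calc (1 : ℝ) ≤ (m * x) ^ n := one_le_pow₀ hone
    _ = m ^ n * (x : ℝ) ^ n := mul_pow _ _ _
    _ ≤ c n * (x : ℝ) ^ n := mul_le_mul_of_nonneg_right hmn (pow_nonneg x.coe_nonneg n)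

lemma rho_le_rho (f : ℕ → Polynomial ℕ) {a b : ℝ} (ha : 0 ≤ a) (hab : a ≤ b) :
    rho f b ≤ rho f a := by
  simpa [rho] using mul_radius_le_radius 1 (fun n => eval₂_castRingHom_nonneg (f n) ha)
    (fun n => by simpa using eval₂_castRingHom_mono (f n) ha hab)

lemma ofReal_div_mul_rho_le_rho {f : ℕ → Polynomial ℕ} (hdeg : ∀ n, (f n).natDegree ≤ n)
    {a b : ℝ} (ha : 0 < a) (hab : a ≤ b) :
    ENNReal.ofReal (a / b) * rho f a ≤ rho f b := by
  have hb : 0 < b := ha.trans_le hab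
  refine mul_radius_le_radius _ (fun n => eval₂_castRingHom_nonneg (f n) hb.le) fun n => ?_
  rw [Real.coe_toNNReal _ (div_pos ha hb).le]
  have h := eval₂_castRingHom_mul_le (f n) (hdeg n) ha.le ((one_le_div ha).mpr hab)
  rw [div_mul_cancel₀ _ ha.ne'] at h
  calc _ ≤ (b / a) ^ n * (f n).eval₂ (Nat.castRingHom ℝ) a * (a / b) ^ n :=
        mul_le_mul_of_nonneg_right h (pow_nonneg (div_pos ha hb).le n)
    _ = (b / a * (a / b)) ^ n * (f n).eval₂ (Nat.castRingHom ℝ) a := by rw [mul_pow]; ring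
    _ = (f n).eval₂ (Nat.castRingHom ℝ) a := by
        rw [div_mul_div_cancel₀ ha.ne', div_self hb.ne', one_pow, one_mul]

lemma rho_lt_top {f : ℕ → Polynomial ℕ} (hdeg : ∀ n, (f n).natDegree ≤ n)
    (hinf : ∀ N, ∃ n, N ≤ n ∧ f n ≠ 0) {a : ℝ} (ha : 0 < a) : rho f a < ⊤ := by
  refine radius_lt_top_of_frequently_pow_le (lt_min one_pos ha) fun N => ?_
  obtain ⟨n, hn, hfn⟩ := hinf N
  exact ⟨n, hn, min_one_pow_le_eval₂_castRingHom hfn (hdeg n) ha⟩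

lemma min_mul_rho_le_rho {f : ℕ → Polynomial ℕ} (hdeg : ∀ n, (f n).natDegree ≤ n)
    {a b : ℝ} (ha : 0 < a) (hb : 0 < b) :
    ENNReal.ofReal (min (a / b) 1) * rho f a ≤ rho f b := by
  rcases le_total a b with hab | hab
  · exact (mul_le_mul_left (ENNReal.ofReal_le_ofReal (min_le_left _ _)) _).trans
      (ofReal_div_mul_rho_le_rho hdeg ha hab)
  · rw [min_eq_right ((one_le_div hb).mpr hab), ENNReal.ofReal_one, one_mul]
    exact rho_le_rho f hb.le hab

lemma rho_le_max_mul_rho {f : ℕ → Polynomial ℕ} (hdeg : ∀ n, (f n).natDegree ≤ n)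
    {a b : ℝ} (ha : 0 < a) (hb : 0 < b) :
    rho f b ≤ ENNReal.ofReal (max (a / b) 1) * rho f a := by
  have h := min_mul_rho_le_rho hdeg hb ha
  have hinv : max (a / b) 1 * min (b / a) 1 = 1 := by
    rcases le_total a b with hab | hab
    · rw [max_eq_right ((div_le_one hb).mpr hab), min_eq_right ((one_le_div ha).mpr hab), one_mul]
    · rw [max_eq_left ((one_le_div hb).mpr hab), min_eq_left ((div_le_one ha).mpr hab),
        div_mul_div_cancel₀ hb.ne', div_self ha.ne']
  calc rho f b = ENNReal.ofReal (max (a / b) 1) *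
        (ENNReal.ofReal (min (b / a) 1) * rho f b) := by
        rw [← mul_assoc, ← ENNReal.ofReal_mul (zero_le_one.trans (le_max_right _ _)), hinv,
          ENNReal.ofReal_one, one_mul]
    _ ≤ _ := by gcongr

lemma continuousOn_rho {f : ℕ → Polynomial ℕ} (hdeg : ∀ n, (f n).natDegree ≤ n)
    (hinf : ∀ N, ∃ n, N ≤ n ∧ f n ≠ 0) : ContinuousOn (rho f) (Set.Ioi 0) := by
  intro a ha
  have ha : 0 < a := ha
  have hdiv : Tendsto (fun b : ℝ => a / b) (𝓝[Set.Ioi 0] a) (𝓝 1) := by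
    have h : ContinuousAt (fun b : ℝ => a / b) a := continuousAt_const.div continuousAt_id ha.ne'
    simpa [ContinuousAt, div_self ha.ne'] using h.mono_left nhdsWithin_le_nhds
  have key : ∀ g : ℝ → ℝ, Tendsto g (𝓝[Set.Ioi 0] a) (𝓝 1) →
      Tendsto (fun b => ENNReal.ofReal (g b) * rho f a) (𝓝[Set.Ioi 0] a) (𝓝 (rho f a)) := by
    intro g hg
    simpa using ENNReal.Tendsto.mul_const (ENNReal.tendsto_ofReal hg)
      (Or.inr (rho_lt_top hdeg hinf ha).ne)
  refine tendsto_of_tendsto_of_tendsto_of_le_of_le'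
    (key (fun b => min (a / b) 1) (by simpa using hdiv.min (tendsto_const_nhds (x := (1 : ℝ)))))
    (key (fun b => max (a / b) 1) (by simpa using hdiv.max (tendsto_const_nhds (x := (1 : ℝ))))) ?_ ?_
  · filter_upwards [self_mem_nhdsWithin] with b hb using min_mul_rho_le_rho hdeg ha hb
  · filter_upwards [self_mem_nhdsWithin] with b hb using rho_le_max_mul_rho hdeg ha hb

/-- Let `(f_n)` be polynomials with nonnegative integer coefficients, `f_n` of
degree at most `n`, infinitely many of them nonzero. Then the radius of
convergence `rho f` is non-increasing on `[0,∞)`, finite on `(0,∞)`,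
continuous on `(0,∞)`, and `rho f a' ≥ (a/a') * rho f a` for `0 < a ≤ a'`. -/
theorem radius_monotone_finite_continuous (f : ℕ → Polynomial ℕ)
    (hdeg : ∀ n, (f n).natDegree ≤ n) (hinf : ∀ N, ∃ n, N ≤ n ∧ f n ≠ 0) :
    (∀ a a' : ℝ, 0 ≤ a → a ≤ a' → rho f a' ≤ rho f a) ∧
    (∀ a : ℝ, 0 < a → rho f a < ⊤) ∧
    ContinuousOn (rho f) (Set.Ioi 0) ∧
    (∀ a a' : ℝ, 0 < a → a ≤ a' → ENNReal.ofReal (a / a') * rho f a ≤ rho f a') := by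
  exact ⟨fun _ _ ha hab => rho_le_rho f ha hab, fun _ ha => rho_lt_top hdeg hinf ha,
    continuousOn_rho hdeg hinf, fun _ _ ha hab => ofReal_div_mul_rho_le_rho hdeg ha hab⟩
end

section
/- As n tends to infinity, C_n * C_{n+1} is asymptotically equivalent to (4/pi) * 16^n * n^{-3}, and sum_{i=0}^{n} binom(n, i) * C_i * C_{n-i} is asymptotically equivalent to (1/pi) * 8^{n+1} * n^{-3}. Consequently, the radius of convergence of the power series sum_n C_n C_{n+1} u^n is 1/16, and the radius of convergence of the power series sum_n (sum_{i=0}^{n} binom(n,i) C_i C_{n-i}) u^n is 1/8. -/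
open Filter Asymptotics

/-- Absorption identity for binomial coefficients, iterated `k` times. -/
theorem choose_mul_ascFactorial_succ (n i k : ℕ) :
    n.choose i * (n + 1).ascFactorial k =
      (n + k).choose (i + k) * (i + 1).ascFactorial k := by
  induction k with
  | zero => simp
  | succ k ih =>
    rw [Nat.ascFactorial_succ, Nat.ascFactorial_succ]
    have h := Nat.add_one_mul_choose_eq (n + k) (i + k)
    calc n.choose i * ((n + 1 + k) * (n + 1).ascFactorial k)
        = (n + k + 1) * (n.choose i * (n + 1).ascFactorial k) := by ring
      _ = ((n + k + 1) * (n + k).choose (i + k)) * (i + 1).ascFactorial k := by rw [ih]; ring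
      _ = _ := by rw [h, ← add_assoc, ← add_assoc]; ring

/-- Inverse factorial moments of the binomial distribution. -/
theorem sum_choose_div_ascFactorial_le (n k : ℕ) :
    ∑ i ∈ Finset.range (n + 1), (n.choose i : ℝ) / ((i + 1).ascFactorial k : ℝ) ≤
      2 ^ (n + k) / ((n + 1).ascFactorial k : ℝ) := by
  have hpos (m : ℕ) : (0 : ℝ) < ((m + 1).ascFactorial k : ℝ) := by
    exact_mod_cast Nat.ascFactorial_pos _ _
  have hterm (i : ℕ) : (n.choose i : ℝ) / ((i + 1).ascFactorial k : ℝ) =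
      ((n + k).choose (k + i) : ℝ) / ((n + 1).ascFactorial k : ℝ) := by
    rw [div_eq_div_iff (hpos i).ne' (hpos n).ne', add_comm k i]
    exact_mod_cast choose_mul_ascFactorial_succ n i k
  simp_rw [hterm]
  rw [← Finset.sum_div]
  gcongr
  have h := Nat.sum_range_choose (n + k)
  rw [show n + k + 1 = k + (n + 1) by ring, Finset.sum_range_add] at h
  exact_mod_cast (Nat.le_add_left _ _).trans h.le

/-- The third moment of the binomial distribution about an arbitrary point. -/
theorem sum_choose_mul_add_pow_three (n : ℕ) (a : ℝ) :
    ∑ i ∈ Finset.range (n + 1), (n.choose i : ℝ) * (i + a) ^ 3 =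
      2 ^ n * ((n + 2 * a) ^ 3 + 3 * n * (n + 2 * a)) / 8 := by
  induction n generalizing a with
  | zero => simp; ring
  | succ n ih =>
    rw [Finset.sum_choose_succ_mul (fun i _ => ((i : ℝ) + a) ^ 3) n]
    have h := ih (a + 1)
    simp only [Nat.cast_add, Nat.cast_one, add_assoc, add_comm (1 : ℝ)] at h ⊢
    rw [ih a, h]
    ring

/-- The Catalan numbers normalised by their exponential growth rate. -/
noncomputable def scaledCatalan (n : ℕ) : ℝ := catalan n / 4 ^ n

theorem scaledCatalan_pos (n : ℕ) : 0 < scaledCatalan n := by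
  have h := succ_mul_catalan_eq_centralBinom n
  have h2 := Nat.centralBinom_pos n
  have : 0 < catalan n := Nat.pos_of_mul_pos_left (h ▸ h2)
  unfold scaledCatalan
  positivity

theorem scaledCatalan_succ (n : ℕ) :
    scaledCatalan (n + 1) = scaledCatalan n * ((2 * n + 1) / (2 * n + 4)) := by
  have h := Nat.succ_mul_centralBinom_succ n
  rw [← succ_mul_catalan_eq_centralBinom, ← succ_mul_catalan_eq_centralBinom] at h
  have h' : ((n : ℝ) + 1) * ((n + 1 + 1) * catalan (n + 1)) =
      2 * (2 * n + 1) * ((n + 1) * catalan n) := by exact_mod_cast h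
  have hn : (n : ℝ) + 1 ≠ 0 := by positivity
  have h'' : ((n : ℝ) + 2) * catalan (n + 1) = 2 * (2 * n + 1) * catalan n := by
    apply mul_left_cancel₀ hn
    linear_combination h'
  unfold scaledCatalan
  rw [pow_succ]
  field_simp
  linear_combination 2 * h''

theorem wallis_mul_scaledCatalan_sq (n : ℕ) :
    Real.Wallis.W n * ((2 * n + 1) * (n + 1) ^ 2 * scaledCatalan n ^ 2) = 1 := by
  induction n with
  | zero => simp [Real.Wallis.W, scaledCatalan]
  | succ n ih =>
    rw [Real.Wallis.W_succ, scaledCatalan_succ]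
    refine Eq.trans ?_ ih
    push_cast
    rw [show 2 * ((n : ℝ) + 1) + 1 = 2 * n + 3 by ring, show (n : ℝ) + 1 + 1 = n + 2 by ring,
      show 2 * (n : ℝ) + 4 = 2 * (n + 2) by ring]
    field_simp

theorem le_scaledCatalan_sq (n : ℕ) :
    1 / (Real.pi * (n + 1 / 2) * (n + 1) ^ 2) ≤ scaledCatalan n ^ 2 := by
  have hW := Real.Wallis.W_le n
  have h := wallis_mul_scaledCatalan_sq n
  have hpi := Real.pi_pos
  rw [div_le_iff₀ (by positivity)]
  calc (1 : ℝ) = Real.Wallis.W n * ((2 * n + 1) * (n + 1) ^ 2 * scaledCatalan n ^ 2) := h.symm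
    _ ≤ Real.pi / 2 * ((2 * n + 1) * (n + 1) ^ 2 * scaledCatalan n ^ 2) := by gcongr
    _ = _ := by ring

theorem scaledCatalan_sq_le (n : ℕ) :
    scaledCatalan n ^ 2 ≤ 1 / (Real.pi * (n + 1 / 2) ^ 2 * (n + 1)) := by
  have hW := Real.Wallis.le_W n
  have h := wallis_mul_scaledCatalan_sq n
  have hpi := Real.pi_pos
  rw [le_div_iff₀ (by positivity)]
  calc scaledCatalan n ^ 2 * (Real.pi * (n + 1 / 2) ^ 2 * (n + 1))
      = ((2 : ℝ) * n + 1) / (2 * n + 2) * (Real.pi / 2) *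
        ((2 * n + 1) * (n + 1) ^ 2 * scaledCatalan n ^ 2) := by field_simp
    _ ≤ Real.Wallis.W n * ((2 * n + 1) * (n + 1) ^ 2 * scaledCatalan n ^ 2) := by gcongr
    _ = 1 := h

theorem scaledCatalan_sq_le_ascFactorial (n : ℕ) :
    scaledCatalan n ^ 2 ≤ 1 / Real.pi *
      (1 / ((n + 1).ascFactorial 3 : ℝ) + 100 / ((n + 1).ascFactorial 4 : ℝ)) := by
  refine (scaledCatalan_sq_le n).trans ?_
  have hpi := Real.pi_pos
  simp only [Nat.ascFactorial_succ, Nat.ascFactorial_zero]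
  push_cast
  have : 1 / (((n : ℝ) + 1 / 2) ^ 2 * (n + 1)) ≤
      (n + 104) / ((n + 1) * (n + 2) * (n + 3) * (n + 4)) := by
    rw [div_le_div_iff₀ (by positivity) (by positivity)]
    have hn : (0 : ℝ) ≤ n := n.cast_nonneg
    have key : ((n : ℝ) + 2) * (n + 3) * (n + 4) ≤ (n + 104) * (n + 1 / 2) ^ 2 := by nlinarith
    nlinarith [mul_le_mul_of_nonneg_right key (by positivity : (0 : ℝ) ≤ n + 1)]
  calc 1 / (Real.pi * ((n : ℝ) + 1 / 2) ^ 2 * (n + 1))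
      = 1 / Real.pi * (1 / (((n : ℝ) + 1 / 2) ^ 2 * (n + 1))) := by field_simp
    _ ≤ 1 / Real.pi * ((n + 104) / ((n + 1) * (n + 2) * (n + 3) * (n + 4))) := by gcongr
    _ = _ := by
      congr 1
      rw [show (n : ℝ) + 1 + 3 = n + 4 by ring, show (n : ℝ) + 1 + 2 = n + 3 by ring,
        show (n : ℝ) + 1 + 1 = n + 2 by ring]
      field_simp
      ring

/-- The binomial average `2⁻ⁿ ∑ binom(n,i) f(i) f(n-i)` of the normalised Catalan numbers `f`. -/
noncomputable def binomialCatalan (n : ℕ) : ℝ :=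
  (∑ i ∈ Finset.range (n + 1), (n.choose i : ℝ) * (scaledCatalan i * scaledCatalan (n - i))) /
    2 ^ n

theorem sum_choose_mul_reflect (n : ℕ) (g : ℕ → ℝ) :
    ∑ i ∈ Finset.range (n + 1), (n.choose i : ℝ) * g (n - i) =
      ∑ i ∈ Finset.range (n + 1), (n.choose i : ℝ) * g i := by
  rw [← Finset.sum_flip]
  refine Finset.sum_congr rfl fun i hi => ?_
  have hi' : i ≤ n := Nat.lt_succ_iff.mp (Finset.mem_range.mp hi)
  rw [Nat.choose_symm hi', Nat.sub_sub_self hi']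

/-- Since `xy ≤ (x² + y²)/2`, a symmetric binomial sum of products is at most the sum of squares. -/
theorem sum_choose_mul_mul_reflect_le (n : ℕ) (g : ℕ → ℝ) :
    ∑ i ∈ Finset.range (n + 1), (n.choose i : ℝ) * (g i * g (n - i)) ≤
      ∑ i ∈ Finset.range (n + 1), (n.choose i : ℝ) * g i ^ 2 := by
  have h := sum_choose_mul_reflect n fun i => g i ^ 2
  have h2 : ∑ i ∈ Finset.range (n + 1), (n.choose i : ℝ) * (g i * g (n - i)) ≤
      ∑ i ∈ Finset.range (n + 1),
        ((n.choose i : ℝ) * g i ^ 2 + (n.choose i : ℝ) * g (n - i) ^ 2) / 2 := by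
    refine Finset.sum_le_sum fun i _ => ?_
    rw [← mul_add, mul_div_assoc]
    gcongr
    linarith [two_mul_le_add_sq (g i) (g (n - i))]
  rw [← Finset.sum_div, Finset.sum_add_distrib, h] at h2
  linarith

theorem binomialCatalan_le (n : ℕ) :
    binomialCatalan n ≤ 8 / Real.pi * ((n + 204) / ((n + 1) * (n + 2) * (n + 3) * (n + 4))) := by
  have hpi := Real.pi_pos
  unfold binomialCatalan
  rw [div_le_iff₀ (by positivity)]
  calc _ ≤ _ := sum_choose_mul_mul_reflect_le n scaledCatalan
    _ ≤ ∑ i ∈ Finset.range (n + 1), (n.choose i : ℝ) * (1 / Real.pi *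
          (1 / ((i + 1).ascFactorial 3 : ℝ) + 100 / ((i + 1).ascFactorial 4 : ℝ))) := by
      gcongr with i
      exact scaledCatalan_sq_le_ascFactorial i
    _ = 1 / Real.pi *
          (∑ i ∈ Finset.range (n + 1), (n.choose i : ℝ) / ((i + 1).ascFactorial 3 : ℝ) +
          100 * ∑ i ∈ Finset.range (n + 1), (n.choose i : ℝ) / ((i + 1).ascFactorial 4 : ℝ)) := by
      rw [Finset.mul_sum, ← Finset.sum_add_distrib, Finset.mul_sum]
      refine Finset.sum_congr rfl fun i _ => by ring
    _ ≤ 1 / Real.pi * (2 ^ (n + 3) / ((n + 1).ascFactorial 3 : ℝ) +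
          100 * (2 ^ (n + 4) / ((n + 1).ascFactorial 4 : ℝ))) := by
      gcongr
      · exact sum_choose_div_ascFactorial_le n 3
      · exact sum_choose_div_ascFactorial_le n 4
    _ = _ := by
      simp only [Nat.ascFactorial_succ, Nat.ascFactorial_zero]
      push_cast
      rw [show (n : ℝ) + 1 + 3 = n + 4 by ring, show (n : ℝ) + 1 + 2 = n + 3 by ring,
        show (n : ℝ) + 1 + 1 = n + 2 by ring]
      field_simp
      ring

theorem le_binomialCatalan (n : ℕ) :
    8 / (Real.pi * ((n + 2) ^ 3 + 3 * n * (n + 2))) ≤ binomialCatalan n := by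
  have hpi := Real.pi_pos
  have hf := scaledCatalan_pos
  have hrec : ∑ i ∈ Finset.range (n + 1),
      (n.choose i : ℝ) * ((scaledCatalan i)⁻¹ * (scaledCatalan (n - i))⁻¹) ≤
      Real.pi * (2 ^ n * ((n + 2) ^ 3 + 3 * n * (n + 2)) / 8) := by
    calc _ ≤ _ := sum_choose_mul_mul_reflect_le n fun i => (scaledCatalan i)⁻¹
      _ ≤ ∑ i ∈ Finset.range (n + 1), (n.choose i : ℝ) * (Real.pi * (i + 1) ^ 3) := by
        gcongr with i
        have h := inv_anti₀ (by positivity) (le_scaledCatalan_sq i)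
        rw [one_div, inv_inv] at h
        rw [inv_pow]
        refine h.trans ?_
        calc Real.pi * ((i : ℝ) + 1 / 2) * (i + 1) ^ 2 ≤ Real.pi * (i + 1) * (i + 1) ^ 2 := by
              gcongr; norm_num
          _ = _ := by ring
      _ = Real.pi * ∑ i ∈ Finset.range (n + 1), (n.choose i : ℝ) * (i + 1) ^ 3 := by
        rw [Finset.mul_sum]
        exact Finset.sum_congr rfl fun i _ => by ring
      _ = _ := by rw [sum_choose_mul_add_pow_three, mul_one]
  have hcs := Finset.sum_sq_le_sum_mul_sum_of_sq_le_mul (Finset.range (n + 1))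
    (r := fun i => (n.choose i : ℝ))
    (f := fun i => (n.choose i : ℝ) * (scaledCatalan i * scaledCatalan (n - i)))
    (g := fun i => (n.choose i : ℝ) * ((scaledCatalan i)⁻¹ * (scaledCatalan (n - i))⁻¹))
    (fun i _ => by have := hf i; have := hf (n - i); positivity)
    (fun i _ => by have := hf i; have := hf (n - i); positivity)
    (fun i _ => by have := (hf i).ne'; have := (hf (n - i)).ne'; field_simp; rfl)
  have hsum : ∑ i ∈ Finset.range (n + 1), (n.choose i : ℝ) = 2 ^ n := by
    exact_mod_cast Nat.sum_range_choose n
  rw [hsum] at hcs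
  have hS : 0 ≤ ∑ i ∈ Finset.range (n + 1),
      (n.choose i : ℝ) * (scaledCatalan i * scaledCatalan (n - i)) :=
    Finset.sum_nonneg fun i _ => by have := hf i; have := hf (n - i); positivity
  have hfin := hcs.trans (mul_le_mul_of_nonneg_left hrec hS)
  unfold binomialCatalan
  rw [div_le_div_iff₀ (by positivity) (by positivity)]
  have h2 : (0 : ℝ) < 2 ^ n := by positivity
  refine le_of_mul_le_mul_right ?_ h2
  linarith

/-- A sequence which agrees with `h (1/n)` for `n > 0`, with `h` continuous at `0`, tends to
`h 0`. -/
theorem tendsto_of_eq_comp_inv {u : ℕ → ℝ} {h : ℝ → ℝ} {L : ℝ} (hc : ContinuousAt h 0)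
    (h0 : h 0 = L) (hu : ∀ n : ℕ, 0 < n → u n = h (n : ℝ)⁻¹) : Tendsto u atTop (nhds L) := by
  have := hc.tendsto.comp (tendsto_inv_atTop_nhds_zero_nat (𝕜 := ℝ))
  rw [h0] at this
  refine this.congr' ?_
  filter_upwards [eventually_gt_atTop 0] with n hn
  exact (hu n hn).symm

theorem tendsto_scaledCatalan_mul_succ :
    Tendsto (fun n : ℕ => Real.pi * n ^ 3 * (scaledCatalan n * scaledCatalan (n + 1))) atTop
      (nhds 1) := by
  have hpi := Real.pi_pos
  refine tendsto_of_tendsto_of_tendsto_of_le_of_le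
    (g := fun n : ℕ => (n : ℝ) ^ 3 / ((n + 1 / 2) * (n + 1) ^ 2) * ((2 * n + 1) / (2 * n + 4)))
    (h := fun n : ℕ => (n : ℝ) ^ 3 / ((n + 1 / 2) ^ 2 * (n + 1)) * ((2 * n + 1) / (2 * n + 4)))
    ?_ ?_ ?_ ?_
  · refine tendsto_of_eq_comp_inv
      (h := fun x => 1 / ((1 + x / 2) * (1 + x) ^ 2) * ((2 + x) / (2 + 4 * x))) ?_ (by norm_num) ?_
    · fun_prop (disch := norm_num)
    · intro n hn
      field_simp
  · refine tendsto_of_eq_comp_inv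
      (h := fun x => 1 / ((1 + x / 2) ^ 2 * (1 + x)) * ((2 + x) / (2 + 4 * x))) ?_ (by norm_num) ?_
    · fun_prop (disch := norm_num)
    · intro n hn
      field_simp
  · intro n
    dsimp only
    rw [scaledCatalan_succ]
    calc _ = Real.pi * (n : ℝ) ^ 3 * (1 / (Real.pi * (n + 1 / 2) * (n + 1) ^ 2) *
          ((2 * n + 1) / (2 * n + 4))) := by field_simp
      _ ≤ Real.pi * (n : ℝ) ^ 3 * (scaledCatalan n ^ 2 * ((2 * n + 1) / (2 * n + 4))) := by
        gcongr
        exact le_scaledCatalan_sq n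
      _ = _ := by ring
  · intro n
    dsimp only
    rw [scaledCatalan_succ]
    calc _ = Real.pi * (n : ℝ) ^ 3 * (scaledCatalan n ^ 2 * ((2 * n + 1) / (2 * n + 4))) := by ring
      _ ≤ Real.pi * (n : ℝ) ^ 3 * (1 / (Real.pi * (n + 1 / 2) ^ 2 * (n + 1)) *
          ((2 * n + 1) / (2 * n + 4))) := by
        gcongr
        exact scaledCatalan_sq_le n
      _ = _ := by field_simp

theorem tendsto_binomialCatalan :
    Tendsto (fun n : ℕ => Real.pi / 8 * n ^ 3 * binomialCatalan n) atTop (nhds 1) := by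
  have hpi := Real.pi_pos
  refine tendsto_of_tendsto_of_tendsto_of_le_of_le
    (g := fun n : ℕ => (n : ℝ) ^ 3 / ((n + 2) ^ 3 + 3 * n * (n + 2)))
    (h := fun n : ℕ => (n : ℝ) ^ 3 * ((n + 204) / ((n + 1) * (n + 2) * (n + 3) * (n + 4))))
    ?_ ?_ ?_ ?_
  · refine tendsto_of_eq_comp_inv
      (h := fun x => 1 / ((1 + 2 * x) ^ 3 + 3 * x * (1 + 2 * x))) ?_ (by norm_num) ?_
    · fun_prop (disch := norm_num)
    · intro n hn
      field_simp
  · refine tendsto_of_eq_comp_inv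
      (h := fun x => (1 + 204 * x) / ((1 + x) * (1 + 2 * x) * (1 + 3 * x) * (1 + 4 * x)))
      ?_ (by norm_num) ?_
    · fun_prop (disch := norm_num)
    · intro n hn
      field_simp
  · intro n
    dsimp only
    calc _ = Real.pi / 8 * (n : ℝ) ^ 3 * (8 / (Real.pi * ((n + 2) ^ 3 + 3 * n * (n + 2)))) := by
          field_simp
      _ ≤ _ := by
        gcongr
        exact le_binomialCatalan n
  · intro n
    dsimp only
    calc _ ≤ Real.pi / 8 * (n : ℝ) ^ 3 *
          (8 / Real.pi * ((n + 204) / ((n + 1) * (n + 2) * (n + 3) * (n + 4)))) := by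
          gcongr
          exact binomialCatalan_le n
      _ = _ := by field_simp

theorem catalan_eq_scaledCatalan (n : ℕ) : (catalan n : ℝ) = 4 ^ n * scaledCatalan n := by
  unfold scaledCatalan
  field_simp

theorem isEquivalent_catalan_mul_catalan_succ :
    IsEquivalent atTop (fun n : ℕ => (catalan n * catalan (n + 1) : ℝ))
      (fun n : ℕ => 4 / Real.pi * 16 ^ n * (n : ℝ) ^ (-3 : ℤ)) := by
  have hpi := Real.pi_pos
  refine isEquivalent_of_tendsto_one (tendsto_scaledCatalan_mul_succ.congr fun n => ?_)
  simp only [Pi.div_apply]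
  rw [catalan_eq_scaledCatalan, catalan_eq_scaledCatalan, zpow_neg,
    show (16 : ℝ) = 4 * 4 by norm_num, mul_pow, show (3 : ℤ) = (3 : ℕ) by rfl, zpow_natCast]
  field_simp
  ring

theorem sum_choose_mul_catalan_eq (n : ℕ) :
    ∑ i ∈ Finset.range (n + 1), ((n.choose i * catalan i * catalan (n - i) : ℕ) : ℝ) =
      8 ^ n * binomialCatalan n := by
  unfold binomialCatalan
  rw [show (8 : ℝ) = 4 * 2 by norm_num, mul_pow, mul_assoc, mul_div_cancel₀ _ (by positivity),
    Finset.mul_sum]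
  refine Finset.sum_congr rfl fun i hi => ?_
  have hi' : i ≤ n := Nat.lt_succ_iff.mp (Finset.mem_range.mp hi)
  push_cast
  rw [catalan_eq_scaledCatalan, catalan_eq_scaledCatalan,
    show (4 : ℝ) ^ n = 4 ^ i * 4 ^ (n - i) by rw [← pow_add, Nat.add_sub_cancel' hi']]
  ring

theorem isEquivalent_sum_choose_mul_catalan :
    IsEquivalent atTop
      (fun n : ℕ => ∑ i ∈ Finset.range (n + 1),
        ((n.choose i * catalan i * catalan (n - i) : ℕ) : ℝ))
      (fun n : ℕ => 1 / Real.pi * 8 ^ (n + 1) * (n : ℝ) ^ (-3 : ℤ)) := by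
  have hpi := Real.pi_pos
  refine isEquivalent_of_tendsto_one (tendsto_binomialCatalan.congr fun n => ?_)
  simp only [Pi.div_apply]
  rw [sum_choose_mul_catalan_eq, zpow_neg, show (3 : ℤ) = (3 : ℕ) by rfl, zpow_natCast]
  field_simp
  ring

/-- A sequence equivalent to `K ρⁿ n⁻³` is the coefficient sequence of a power series of radius
`ρ⁻¹`. -/
theorem radius_of_isEquivalent {c : ℕ → ℝ} {K : ℝ} {ρ : NNReal} (hK : K ≠ 0) (hρ : 0 < ρ)
    (h : IsEquivalent atTop c fun n : ℕ => K * (ρ : ℝ) ^ n * (n : ℝ) ^ (-3 : ℤ)) :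
    radius c = (ρ : ENNReal)⁻¹ := by
  have hρ' : (0 : ℝ) < ρ := hρ
  have hiff (x : NNReal) : (Summable fun n => c n * (x : ℝ) ^ n) ↔
      Summable fun n : ℕ => K * ((ρ * x : ℝ) ^ n / (n : ℝ) ^ 3) := by
    refine (h.mul (IsEquivalent.refl (u := fun n : ℕ => (x : ℝ) ^ n))).summable_iff_nat.trans
      (summable_congr fun n => ?_)
    simp only [Pi.mul_apply]
    rw [zpow_neg, show (3 : ℤ) = (3 : ℕ) by rfl, zpow_natCast, mul_pow]
    ring
  rw [← ENNReal.coe_inv hρ.ne']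
  apply le_antisymm
  · refine sSup_le ?_
    rintro _ ⟨x, rfl, hx⟩
    rw [ENNReal.coe_le_coe]
    by_contra! hlt
    have h1 : (1 : ℝ) < ρ * x := by
      have : (ρ : ℝ)⁻¹ < x := by exact_mod_cast hlt
      rwa [inv_lt_iff_one_lt_mul₀' hρ'] at this
    rw [hiff, summable_mul_left_iff hK] at hx
    have hprod := hx.tendsto_atTop_zero.mul (tendsto_pow_const_div_const_pow_of_one_lt 3 h1)
    refine zero_ne_one ((mul_zero (0 : ℝ)).symm.trans (tendsto_nhds_unique hprod ?_))
    refine tendsto_const_nhds.congr' ?_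
    filter_upwards [eventually_gt_atTop 0] with n hn
    have : (0 : ℝ) < ρ * x := by linarith
    field_simp
  · refine le_sSup ⟨ρ⁻¹, rfl, ?_⟩
    rw [hiff]
    refine Summable.mul_left K ?_
    simp only [NNReal.coe_inv, mul_inv_cancel₀ hρ'.ne', one_pow]
    exact Real.summable_one_div_nat_pow.mpr (by norm_num)

/-- `C_n C_{n+1} ~ (4/π) 16^n n⁻³` and
`∑_{i=0}^n binom(n,i) C_i C_{n-i} ~ (1/π) 8^{n+1} n⁻³`; consequently the
corresponding power series have radii of convergence `1/16` and `1/8`. -/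
theorem catalan_products_asymptotics_and_radii :
    (IsEquivalent atTop (fun n : ℕ => (catalan n * catalan (n + 1) : ℝ))
      (fun n : ℕ => 4 / Real.pi * 16 ^ n * (n : ℝ) ^ (-3 : ℤ))) ∧
    (IsEquivalent atTop
      (fun n : ℕ => ∑ i ∈ Finset.range (n + 1),
        ((n.choose i * catalan i * catalan (n - i) : ℕ) : ℝ))
      (fun n : ℕ => 1 / Real.pi * 8 ^ (n + 1) * (n : ℝ) ^ (-3 : ℤ))) ∧
    radius (fun n : ℕ => (catalan n * catalan (n + 1) : ℝ)) = 16⁻¹ ∧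
    radius (fun n : ℕ => ∑ i ∈ Finset.range (n + 1),
      ((n.choose i * catalan i * catalan (n - i) : ℕ) : ℝ)) = 8⁻¹ := by
  refine ⟨isEquivalent_catalan_mul_catalan_succ, isEquivalent_sum_choose_mul_catalan, ?_, ?_⟩
  · exact radius_of_isEquivalent (K := 4 / Real.pi) (ρ := 16) (by positivity) (by norm_num)
      isEquivalent_catalan_mul_catalan_succ
  · refine radius_of_isEquivalent (K := 8 / Real.pi) (ρ := 8) (by positivity) (by norm_num) ?_
    convert isEquivalent_sum_choose_mul_catalan using 2 with n
    simp only [NNReal.coe_ofNat]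
    ring
end
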